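/- arXiv:1701.03986 — 2 statements merged into one kernel-verified Lean document; each statement's English description precedes it below -/
import Mathlib

section
/- Let q be a prime power, Q = q², and let n be a positive integer with gcd(n, q) = 1. Write the factorization of x^n − 1 into monic irreducible polynomials over GF(Q), and let u be the number of monic irreducible factors e(x) satisfying e(x) = ē*(x), and 2v the number of the remaining monic irreducible factors (which come in pairs {f(x), f̄*(x)} with f(x) ≠ f̄*(x)). Then the total number of cyclic Hermitian LCD codes of length n over GF(Q), i.e., the number of monic divisors g(x) of x^n − 1 whose associated cyclic code C = ⟨g(x)⟩ satisfies C ∩ C^⊥H = {0} (counting the zero code and GF(Q)^n), equals 2^{u+v}. -/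
open Polynomial

noncomputable section

/-- The cyclic shift of a vector: `(c₀,…,c_{n−1}) ↦ (c_{n−1},c₀,…,c_{n−2})`. -/
def cyclicShift {F : Type*} {n : ℕ} (c : Fin n → F) : Fin n → F :=
  fun i => c ⟨(i.val + (n - 1)) % n, Nat.mod_lt _ i.pos⟩

/-- A linear code (submodule of `F^n`) is cyclic if it is stable under the cyclic shift. -/
def IsCyclicCode {F : Type*} [Field F] {n : ℕ} (C : Submodule F (Fin n → F)) : Prop :=
  ∀ c ∈ C, cyclicShift c ∈ C

/-- The Hermitian dual `C^⊥H = {b : ∑ i, b i * (c i)^q = 0 for all c ∈ C}`. -/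
def hermDualSet {F : Type*} [Field F] (q : ℕ) {n : ℕ} (C : Set (Fin n → F)) :
    Set (Fin n → F) :=
  {b | ∀ c ∈ C, ∑ i, b i * (c i) ^ q = 0}

/-- A code is Hermitian LCD if `C ∩ C^⊥H = {0}`. -/
def IsHermitianLCD {F : Type*} [Field F] (q : ℕ) {n : ℕ} (C : Set (Fin n → F)) : Prop :=
  C ∩ hermDualSet q C = {0}

/-- The polynomial `c₀ + c₁ x + ⋯ + c_{n−1} x^{n−1}` associated with a vector. -/
def polyOfVec {F : Type*} [Field F] {n : ℕ} (c : Fin n → F) : Polynomial F :=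
  ∑ i : Fin n, Polynomial.C (c i) * Polynomial.X ^ (i : ℕ)

/-- The cyclic code of length `n` with generator polynomial `g` (for `g ∣ xⁿ − 1`):
vectors whose associated polynomial (of degree `< n`) is divisible by `g`. -/
def cyclicCodeOf {F : Type*} [Field F] (n : ℕ) (g : Polynomial F) :
    Submodule F (Fin n → F) where
  carrier := {c | g ∣ polyOfVec c}
  add_mem' := by
    intro a b ha hb
    have h : polyOfVec (a + b) = polyOfVec a + polyOfVec b := by
      simp [polyOfVec, add_mul, Finset.sum_add_distrib]
    simpa [Set.mem_setOf_eq, h] using dvd_add ha hb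
  zero_mem' := by simp [polyOfVec]
  smul_mem' := by
    intro r c hc
    have h : polyOfVec (r • c) = Polynomial.C r * polyOfVec c := by
      simp [polyOfVec, Finset.mul_sum, mul_assoc]
    simpa [Set.mem_setOf_eq, h] using hc.mul_left (Polynomial.C r)

/-- `f̄`: the polynomial obtained by raising every coefficient of `f` to the `q`-th power. -/
def conjPoly {F : Type*} [Field F] (q : ℕ) (f : Polynomial F) : Polynomial F :=
  f.sum fun i a => Polynomial.C (a ^ q) * Polynomial.X ^ i

/-- The reciprocal polynomial `f*(x) = f₀⁻¹ xᵗ f(1/x)`. -/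
def recipPoly {F : Type*} [Field F] (f : Polynomial F) : Polynomial F :=
  Polynomial.C (f.coeff 0)⁻¹ * f.reverse

/-- The `Q`-cyclotomic coset of `s` modulo `n`, as a subset of `{0,…,n−1} ⊆ ℕ`
(`s` is taken as an integer so that negative indices are allowed). -/
def cycCoset (Q n : ℕ) (s : ℤ) : Set ℕ :=
  {x | x < n ∧ ∃ j : ℕ, (x : ℤ) ≡ s * (Q : ℤ) ^ j [ZMOD n]}

end

section Combinatorics

/-- Given an involution `φ` of a finite set `P` with `u` fixed points and `2 * v` moved points,
exactly `2 ^ (u + v)` subsets of `P` are stable under `φ`. -/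
theorem card_powerset_filter_involution {α : Type*} [DecidableEq α] (P : Finset α) (φ : α → α)
    (hmem : ∀ p ∈ P, φ p ∈ P) (hinv : ∀ p ∈ P, φ (φ p) = p) {u v : ℕ}
    (hu : (P.filter fun p => φ p = p).card = u)
    (hv : (P.filter fun p => φ p ≠ p).card = 2 * v) :
    (P.powerset.filter fun S => ∀ p ∈ P, φ p ∈ S → p ∈ S).card = 2 ^ (u + v) := by
  classical
  let _ : LinearOrder α := linearOrderOfSTO (WellOrderingRel (α := α))
  set T := P.filter fun p => p ≤ φ p with hT
  have hcard : T.card = u + v := by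
    have h1 : (P.filter fun p => φ p ≤ p).card = T.card := by
      refine Finset.card_bij (fun p _ => φ p) ?_ ?_ ?_
      · simp only [hT, Finset.mem_filter]
        rintro p ⟨hp, h⟩
        exact ⟨hmem p hp, by rwa [hinv p hp]⟩
      · simp only [Finset.mem_filter]
        rintro a ⟨ha, -⟩ b ⟨hb, -⟩ h
        rw [← hinv a ha, h, hinv b hb]
      · simp only [hT, Finset.mem_filter]
        rintro p ⟨hp, h⟩
        exact ⟨φ p, ⟨hmem p hp, by rwa [hinv p hp]⟩, hinv p hp⟩
    have h2 := Finset.card_union_add_card_inter T (P.filter fun p => φ p ≤ p)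
    have h3 : T ∪ (P.filter fun p => φ p ≤ p) = P := by
      rw [hT, ← Finset.filter_or, Finset.filter_true_of_mem]
      exact fun p _ => le_total _ _
    have h4 : T ∩ (P.filter fun p => φ p ≤ p) = P.filter fun p => φ p = p := by
      rw [hT, ← Finset.filter_and]
      exact Finset.filter_congr fun p _ => ⟨fun h => le_antisymm h.2 h.1, fun h => by simp [h]⟩
    have h5 := Finset.card_filter_add_card_filter_not (s := P) (fun p => φ p = p)
    rw [h3, h4, h1] at h2
    simp only [ne_eq] at hv
    omega
  rw [← hcard, ← Finset.card_powerset]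
  refine Finset.card_bij (fun S _ => S.filter fun p => p ≤ φ p) ?_ ?_ ?_
  · simp only [hT, Finset.mem_filter, Finset.mem_powerset]
    rintro S ⟨hS, -⟩
    exact Finset.filter_subset_filter _ hS
  · simp only [Finset.mem_filter, Finset.mem_powerset]
    have key : ∀ S S' : Finset α, S ⊆ P → S' ⊆ P → (∀ p ∈ P, φ p ∈ S → p ∈ S) →
        (∀ p ∈ P, φ p ∈ S' → p ∈ S') →
        (S.filter fun p => p ≤ φ p) = (S'.filter fun p => p ≤ φ p) → S ⊆ S' := by
      intro S S' hS hS' h h' he p hp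
      have hpP := hS hp
      rcases le_total p (φ p) with hle | hle
      · have : p ∈ S'.filter fun p => p ≤ φ p := he ▸ Finset.mem_filter.2 ⟨hp, hle⟩
        exact (Finset.mem_filter.1 this).1
      · have : φ p ∈ S'.filter fun p => p ≤ φ p := by
          refine he ▸ Finset.mem_filter.2 ⟨h _ (hmem p hpP) ?_, ?_⟩ <;> rwa [hinv p hpP]
        exact h' p hpP (Finset.mem_filter.1 this).1
    rintro S ⟨hS, h⟩ S' ⟨hS', h'⟩ he
    exact (key S S' hS hS' h h' he).antisymm (key S' S hS' hS h' h he.symm)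
  · simp only [Finset.mem_filter, Finset.mem_powerset]
    intro R hR
    have hRP : ∀ p ∈ R, p ∈ P ∧ p ≤ φ p := fun p hp => Finset.mem_filter.1 (hR hp)
    refine ⟨P.filter fun p => p ∈ R ∨ φ p ∈ R, ⟨Finset.filter_subset _ _, ?_⟩, ?_⟩
    · intro p hp h
      rw [Finset.mem_filter, hinv p hp] at h
      exact Finset.mem_filter.2 ⟨hp, h.2.symm⟩
    · ext p
      simp only [Finset.mem_filter]
      constructor
      · rintro ⟨⟨hp, h | h⟩, hle⟩
        · exact h
        · have := (hRP _ h).2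
          rw [hinv p hp] at this
          rwa [le_antisymm hle this]
      · exact fun h => ⟨⟨(hRP p h).1, Or.inl h⟩, (hRP p h).2⟩

end Combinatorics

section Reciprocal

variable {F : Type*} [Field F]

theorem recipPoly_mul (f g : F[X]) : recipPoly (f * g) = recipPoly f * recipPoly g := by
  simp only [recipPoly, mul_coeff_zero, mul_inv, C_mul, reverse_mul_of_domain]
  ring

theorem recipPoly_map (φ : F →+* F) (f : F[X]) :
    recipPoly (f.map φ) = (recipPoly f).map φ := by
  simp [recipPoly, reverse, reflect_map, natDegree_map]

theorem natTrailingDegree_of_coeff_zero_ne {f : F[X]} (h : f.coeff 0 ≠ 0) :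
    f.natTrailingDegree = 0 :=
  natTrailingDegree_eq_zero_of_constantCoeff_ne_zero h

theorem natDegree_recipPoly {f : F[X]} (h : f.coeff 0 ≠ 0) :
    (recipPoly f).natDegree = f.natDegree := by
  rw [recipPoly, natDegree_C_mul (inv_ne_zero h), reverse_natDegree,
    natTrailingDegree_of_coeff_zero_ne h, Nat.sub_zero]

theorem monic_recipPoly {f : F[X]} (h : f.coeff 0 ≠ 0) : (recipPoly f).Monic := by
  rw [Monic, recipPoly, leadingCoeff_mul, leadingCoeff_C, reverse_leadingCoeff, trailingCoeff,
    natTrailingDegree_of_coeff_zero_ne h, inv_mul_cancel₀ h]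

theorem recipPoly_recipPoly {f : F[X]} (h : f.coeff 0 ≠ 0) (hf : f.Monic) :
    recipPoly (recipPoly f) = f := by
  have h1 : f.reverse.reverse = f := by
    rw [reverse, reverse_natDegree, natTrailingDegree_of_coeff_zero_ne h, Nat.sub_zero, reverse,
      reflect_reflect]
  have h2 : (recipPoly f).reverse = C (f.coeff 0)⁻¹ * f := by
    rw [recipPoly, reverse_mul_of_domain, reverse_C, h1]
  rw [recipPoly, h2, recipPoly, mul_coeff_zero, coeff_C_zero, coeff_zero_reverse,
    hf.leadingCoeff, mul_one, inv_inv, ← mul_assoc, ← C_mul, mul_inv_cancel₀ h, C_1, one_mul]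

theorem recipPoly_X_pow_sub_one {n : ℕ} (hn : 0 < n) :
    recipPoly (X ^ n - 1 : F[X]) = X ^ n - 1 := by
  have h : (X ^ n - 1 : F[X]) = X ^ (n - 1) * X + C (-1) := by
    rw [← pow_succ, Nat.sub_add_cancel hn, C_neg, C_1, sub_eq_add_neg]
  have h0 : (X ^ n - 1 : F[X]).coeff 0 = -1 := by
    rw [coeff_sub, coeff_X_pow, if_neg hn.ne, coeff_one_zero, zero_sub]
  have h1 : (X ^ (n - 1) : F[X]).reverse = 1 := by
    rw [← one_mul (X ^ (n - 1)), reverse_mul_X_pow, ← C_1, reverse_C]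
  rw [recipPoly, h0, h, reverse_add_C, reverse_mul_X, h1, ← pow_succ, natDegree_X_pow,
    Nat.sub_add_cancel hn]
  simp [C_neg]

theorem coeff_zero_ne_of_dvd {f g : F[X]} (h : f ∣ g) (hg : g.coeff 0 ≠ 0) : f.coeff 0 ≠ 0 := by
  obtain ⟨k, rfl⟩ := h
  rw [mul_coeff_zero] at hg
  exact left_ne_zero_of_mul hg

theorem coeff_zero_ne_of_dvd_X_pow_sub_one {n : ℕ} (hn : 0 < n) {f : F[X]} (h : f ∣ X ^ n - 1) :
    f.coeff 0 ≠ 0 :=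
  coeff_zero_ne_of_dvd h (by simp [coeff_X_pow, hn.ne])

variable (φ : F →+* F)

/-- The conjugate-reciprocal `f̄*` of a polynomial with respect to the ring endomorphism `φ`. -/
noncomputable def conjRecip (f : F[X]) : F[X] := recipPoly (f.map φ)

theorem conjRecip_dvd {f g : F[X]} (h : f ∣ g) : conjRecip φ f ∣ conjRecip φ g := by
  obtain ⟨k, rfl⟩ := h
  rw [conjRecip, conjRecip, Polynomial.map_mul, recipPoly_mul]
  exact dvd_mul_right _ _

theorem coeff_zero_map_ne {f : F[X]} (h : f.coeff 0 ≠ 0) : (f.map φ).coeff 0 ≠ 0 := by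
  rwa [coeff_map, _root_.map_ne_zero]

theorem natDegree_conjRecip {f : F[X]} (h : f.coeff 0 ≠ 0) :
    (conjRecip φ f).natDegree = f.natDegree := by
  rw [conjRecip, natDegree_recipPoly (coeff_zero_map_ne φ h), natDegree_map]

theorem monic_conjRecip {f : F[X]} (h : f.coeff 0 ≠ 0) : (conjRecip φ f).Monic :=
  monic_recipPoly (coeff_zero_map_ne φ h)

theorem conjRecip_X_pow_sub_one {n : ℕ} (hn : 0 < n) :
    conjRecip φ (X ^ n - 1) = X ^ n - 1 := by
  simp [conjRecip, recipPoly_X_pow_sub_one hn]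

variable {φ}

theorem conjRecip_conjRecip (hφ : ∀ a, φ (φ a) = a) {f : F[X]} (h : f.coeff 0 ≠ 0)
    (hf : f.Monic) : conjRecip φ (conjRecip φ f) = f := by
  have h1 : φ.comp φ = RingHom.id F := RingHom.ext hφ
  rw [conjRecip, conjRecip, recipPoly_map, recipPoly_map, recipPoly_map, Polynomial.map_map, h1,
    Polynomial.map_id, recipPoly_recipPoly h hf]

theorem irreducible_conjRecip (hφ : ∀ a, φ (φ a) = a) {f : F[X]} (h : f.coeff 0 ≠ 0)
    (hf : f.Monic) (hirr : Irreducible f) (h0 : (conjRecip φ f).coeff 0 ≠ 0) :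
    Irreducible (conjRecip φ f) := by
  have key : ∀ a : F[X], a.coeff 0 ≠ 0 → IsUnit (conjRecip φ a) → IsUnit a := by
    intro a ha hu
    have ha0 : a ≠ 0 := by rintro rfl; simp at ha
    rw [isUnit_iff_degree_eq_zero, degree_eq_natDegree ha0, ← natDegree_conjRecip φ ha,
      natDegree_eq_zero_of_isUnit hu, Nat.cast_zero]
  refine ⟨fun hu => hirr.not_isUnit (key f h hu), fun a b hab => ?_⟩
  have hfab : f = conjRecip φ a * conjRecip φ b := by
    rw [← conjRecip_conjRecip hφ h hf, hab]
    simp only [conjRecip, Polynomial.map_mul, recipPoly_mul]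
  rw [hab, mul_coeff_zero] at h0
  exact (hirr.isUnit_or_isUnit hfab).imp (key a (left_ne_zero_of_mul h0))
    (key b (right_ne_zero_of_mul h0))

end Reciprocal

section HermitianDual

variable {F : Type*} [Field F]

theorem coeff_polyOfVec {n : ℕ} (c : Fin n → F) (i : Fin n) : (polyOfVec c).coeff i = c i := by
  simp [polyOfVec, coeff_X_pow, Fin.val_inj]

theorem degree_polyOfVec_lt {n : ℕ} (c : Fin n → F) : (polyOfVec c).degree < n :=
  (degree_sum_le _ _).trans_lt <| (Finset.sup_lt_iff (WithBot.bot_lt_coe n)).2 fun i _ =>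
    (degree_C_mul_X_pow_le _ _).trans_lt (Nat.cast_lt.2 i.isLt)

theorem polyOfVec_coeff {n : ℕ} {f : F[X]} (hf : f.degree < n) :
    polyOfVec (fun i : Fin n => f.coeff i) = f := by
  ext k
  rcases lt_or_ge k n with hk | hk
  · exact coeff_polyOfVec _ ⟨k, hk⟩
  · rw [coeff_eq_zero_of_degree_lt (hf.trans_le (Nat.cast_le.2 hk)),
      coeff_eq_zero_of_degree_lt ((degree_polyOfVec_lt _).trans_le (Nat.cast_le.2 hk))]

theorem monic_X_pow_sub_one {n : ℕ} (hn : 0 < n) : (X ^ n - 1 : F[X]).Monic := by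
  simpa using monic_X_pow_sub_C (1 : F) hn.ne'

theorem degree_modByMonic_X_pow_sub_one_lt {n : ℕ} (hn : 0 < n) (f : F[X]) :
    (f %ₘ (X ^ n - 1)).degree < n := by
  have h := degree_modByMonic_lt f (monic_X_pow_sub_one (F := F) hn)
  rwa [← C_1, degree_X_pow_sub_C hn] at h

theorem dvd_sub_modByMonic {g : F[X]} (f : F[X]) : g ∣ f - f %ₘ g :=
  ⟨f /ₘ g, sub_eq_of_eq_add' (modByMonic_add_div f g).symm⟩

theorem polyOfVec_eq_zero_of_dvd {n : ℕ} (hn : 0 < n) {b : Fin n → F}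
    (h : X ^ n - 1 ∣ polyOfVec b) : b = 0 := by
  have h0 : polyOfVec b = 0 := eq_zero_of_dvd_of_degree_lt h <| by
    rw [← C_1, degree_X_pow_sub_C hn]
    exact degree_polyOfVec_lt b
  ext i
  rw [← coeff_polyOfVec b, h0, coeff_zero, Pi.zero_apply]

/-- The constant coefficient of the reduction of a polynomial modulo `X ^ n - 1`. -/
noncomputable def cyclicTrace (n : ℕ) : F[X] →ₗ[F] F :=
  lsum fun i => if n ∣ i then LinearMap.id else 0

theorem cyclicTrace_C_mul_X_pow (n i : ℕ) (a : F) :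
    cyclicTrace n (C a * X ^ i) = if n ∣ i then a else 0 := by
  rw [cyclicTrace, lsum_apply, C_mul_X_pow_eq_monomial, sum_monomial_index _ _ (by simp)]
  split_ifs <;> simp

theorem cyclicTrace_eq_zero_of_dvd {n : ℕ} {f : F[X]} (h : X ^ n - 1 ∣ f) :
    cyclicTrace n f = 0 := by
  obtain ⟨k, rfl⟩ := h
  induction k using Polynomial.induction_on' with
  | add p q hp hq => rw [mul_add, map_add, hp, hq, add_zero]
  | monomial i a =>
    have h : (X ^ n - 1) * monomial i a = C a * X ^ (i + n) - C a * X ^ i := by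
      rw [← C_mul_X_pow_eq_monomial]
      ring
    simp [h, cyclicTrace_C_mul_X_pow]

theorem cyclicTrace_congr {n : ℕ} {f g : F[X]} (h : X ^ n - 1 ∣ f - g) :
    cyclicTrace n f = cyclicTrace n g :=
  sub_eq_zero.1 (by rw [← map_sub, cyclicTrace_eq_zero_of_dvd h])

variable (φ : F →+* F)

/-- The `φ`-semilinear substitution `X ↦ X ^ (n - 1)`, which is `X ↦ X⁻¹` modulo `X ^ n - 1`. -/
noncomputable def conjInv (n : ℕ) : F[X] →+* F[X] :=
  eval₂RingHom (C.comp φ) (X ^ (n - 1))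

theorem X_pow_sub_one_dvd_conjInv (n : ℕ) : (X ^ n - 1 : F[X]) ∣ conjInv φ n (X ^ n - 1) := by
  have h : conjInv φ n (X ^ n - 1) = (X ^ n) ^ (n - 1) - 1 := by
    simp [conjInv, ← pow_mul, mul_comm]
  rw [h]
  exact sub_one_dvd_pow_sub_one _ _

theorem dvd_add_pred_mul_iff {n : ℕ} (i j : Fin n) :
    n ∣ (i : ℕ) + (n - 1) * (j : ℕ) ↔ i = j := by
  have hn : 0 < n := i.pos
  have h : (i : ℕ) + (n - 1) * j + j = i + n * j := by
    obtain ⟨m, rfl⟩ := Nat.exists_eq_succ_of_ne_zero hn.ne'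
    simp
    ring
  have h1 : (i : ℕ) + (n - 1) * j + j ≡ i [MOD n] := by
    rw [h]
    simp [Nat.ModEq]
  constructor
  · intro hd
    have h2 : (i : ℕ) + (n - 1) * j + j ≡ 0 + j [MOD n] :=
      Nat.ModEq.add_right _ ((Nat.modEq_zero_iff_dvd).2 hd)
    rw [zero_add] at h2
    exact Fin.ext ((h1.symm.trans h2).eq_of_lt_of_lt i.isLt j.isLt)
  · rintro rfl
    rw [← Nat.modEq_zero_iff_dvd]
    exact Nat.ModEq.add_right_cancel' (i : ℕ) (by rwa [zero_add])

theorem cyclicTrace_polyOfVec_mul {n : ℕ} (b c : Fin n → F) :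
    cyclicTrace n (polyOfVec b * conjInv φ n (polyOfVec c)) = ∑ i, b i * φ (c i) := by
  have h : ∀ i j : Fin n, C (b i) * X ^ (i : ℕ) * conjInv φ n (C (c j) * X ^ (j : ℕ)) =
      C (b i * φ (c j)) * X ^ ((i : ℕ) + (n - 1) * (j : ℕ)) := by
    intro i j
    simp only [conjInv, coe_eval₂RingHom, eval₂_mul, eval₂_C, eval₂_pow, eval₂_X,
      RingHom.comp_apply, C_mul, pow_add, pow_mul]
    ring
  simp only [polyOfVec, map_sum, Finset.sum_mul_sum, h, cyclicTrace_C_mul_X_pow,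
    dvd_add_pred_mul_iff]
  simp

theorem X_pow_sub_one_dvd_of_cyclicTrace {n : ℕ} (hn : 0 < n) {f : F[X]}
    (h : ∀ k, cyclicTrace n (f * conjInv φ n k) = 0) : X ^ n - 1 ∣ f := by
  have hr : f %ₘ (X ^ n - 1) = 0 := by
    rw [← polyOfVec_coeff (degree_modByMonic_X_pow_sub_one_lt hn f)]
    set b : Fin n → F := fun i => (f %ₘ (X ^ n - 1)).coeff i with hb
    suffices b = 0 by simp [this, polyOfVec]
    ext i
    have h1 := h (polyOfVec (Pi.single i 1))
    rw [cyclicTrace_congr (g := polyOfVec b * conjInv φ n (polyOfVec (Pi.single i 1)))] at h1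
    · simpa [cyclicTrace_polyOfVec_mul, Pi.single_apply, apply_ite φ] using h1
    · rw [← sub_mul, hb, polyOfVec_coeff (degree_modByMonic_X_pow_sub_one_lt hn f)]
      exact (dvd_sub_modByMonic f).mul_right _
  exact (modByMonic_eq_zero_iff_dvd (monic_X_pow_sub_one hn)).1 hr

variable {φ}

theorem mem_hermDualSet_cyclicCodeOf_iff {q : ℕ} (hφ : ∀ a, φ a = a ^ q) {n : ℕ} (hn : 0 < n)
    {g : F[X]} (hg : g ∣ X ^ n - 1) (b : Fin n → F) :
    b ∈ hermDualSet q (cyclicCodeOf n g : Set (Fin n → F)) ↔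
      X ^ n - 1 ∣ polyOfVec b * conjInv φ n g := by
  have hsum : ∀ c : Fin n → F, ∑ i, b i * c i ^ q =
      cyclicTrace n (polyOfVec b * conjInv φ n (polyOfVec c)) := by
    intro c
    simp only [cyclicTrace_polyOfVec_mul, hφ]
  constructor
  · intro hb
    refine X_pow_sub_one_dvd_of_cyclicTrace φ hn fun k => ?_
    have hmod := polyOfVec_coeff (degree_modByMonic_X_pow_sub_one_lt hn (g * k))
    have hsub := dvd_sub_modByMonic (g := X ^ n - 1) (g * k)
    have hmem : (fun i : Fin n => ((g * k) %ₘ (X ^ n - 1)).coeff i) ∈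
        (cyclicCodeOf n g : Set (Fin n → F)) := by
      change g ∣ polyOfVec _
      rw [hmod]
      exact (dvd_sub_right (dvd_mul_right g k)).1 (hg.trans hsub)
    have h0 := hb _ hmem
    rw [hsum, hmod] at h0
    rw [← h0]
    refine cyclicTrace_congr ?_
    rw [mul_assoc, ← map_mul (conjInv φ n), ← mul_sub, ← map_sub]
    exact Dvd.dvd.mul_left ((X_pow_sub_one_dvd_conjInv φ n).trans
      (_root_.map_dvd (conjInv φ n) hsub)) _
  · intro h c hc
    obtain ⟨k, hk⟩ : g ∣ polyOfVec c := hc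
    rw [hsum, hk, map_mul (conjInv φ n), ← mul_assoc]
    exact cyclicTrace_eq_zero_of_dvd (h.mul_right _)

theorem isHermitianLCD_cyclicCodeOf_iff {q : ℕ} (hφ : ∀ a, φ a = a ^ q) {n : ℕ} (hn : 0 < n)
    {g : F[X]} (hg : g ∣ X ^ n - 1) :
    IsHermitianLCD q (cyclicCodeOf n g : Set (Fin n → F)) ↔
      ∀ f, g ∣ f → X ^ n - 1 ∣ f * conjInv φ n g → X ^ n - 1 ∣ f := by
  rw [IsHermitianLCD]
  constructor
  · intro h f hgf hf
    have hmod := polyOfVec_coeff (degree_modByMonic_X_pow_sub_one_lt hn f)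
    have hsub := dvd_sub_modByMonic (g := X ^ n - 1) f
    have hmem : (fun i : Fin n => (f %ₘ (X ^ n - 1)).coeff i) ∈
        (cyclicCodeOf n g : Set (Fin n → F)) ∩ hermDualSet q (cyclicCodeOf n g) := by
      refine ⟨?_, (mem_hermDualSet_cyclicCodeOf_iff hφ hn hg _).2 ?_⟩
      · change g ∣ polyOfVec _
        rw [hmod]
        exact (dvd_sub_right hgf).1 (hg.trans hsub)
      · rw [hmod]
        refine (dvd_sub_right hf).1 ?_
        rw [← sub_mul]
        exact hsub.mul_right _
    rw [h, Set.mem_singleton_iff] at hmem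
    rw [hmem] at hmod
    rw [← modByMonic_eq_zero_iff_dvd (monic_X_pow_sub_one hn), ← hmod]
    simp [polyOfVec]
  · intro h
    refine Set.eq_singleton_iff_unique_mem.2 ⟨⟨zero_mem (cyclicCodeOf n g), ?_⟩, ?_⟩
    · intro c _
      simp
    · rintro b ⟨hb, hb'⟩
      exact polyOfVec_eq_zero_of_dvd hn
        (h _ hb ((mem_hermDualSet_cyclicCodeOf_iff hφ hn hg b).1 hb'))

end HermitianDual

section Factors

variable {F : Type*} [Field F]

theorem dvd_of_squarefree_of_forall_irreducible {f g : F[X]} (hf : Squarefree f)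
    (h : ∀ p : F[X], p.Monic → Irreducible p → p ∣ f → p ∣ g) : f ∣ g := by
  classical
  rcases eq_or_ne g 0 with rfl | hg
  · exact dvd_zero f
  · refine (hf.isRadical.dvd_radical hf.ne_zero).trans ?_
    rw [UniqueFactorizationMonoid.radical_dvd_iff_primeFactors_subset hg]
    intro p hp
    rw [UniqueFactorizationMonoid.mem_primeFactors,
      UniqueFactorizationMonoid.mem_normalizedFactors_iff' hf.ne_zero] at hp
    rw [UniqueFactorizationMonoid.mem_primeFactors,
      UniqueFactorizationMonoid.mem_normalizedFactors_iff' hg]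
    refine ⟨hp.1, hp.2.1, h p ?_ hp.1 hp.2.2⟩
    rw [← hp.2.1]
    exact monic_normalize hp.1.ne_zero

theorem dvd_conjInv_iff {φ : F →+* F} (hφ : ∀ a, φ (φ a) = a) {n : ℕ} (hn : 0 < n) {p g : F[X]}
    (hp : p.Monic) (hirr : Irreducible p) (hpn : p ∣ X ^ n - 1) (hg : g.Monic)
    (hgn : g ∣ X ^ n - 1) : p ∣ conjInv φ n g ↔ conjRecip φ p ∣ g := by
  have : Fact (Irreducible p) := ⟨hirr⟩
  have hp0 := coeff_zero_ne_of_dvd_X_pow_sub_one hn hpn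
  have hg0 := coeff_zero_ne_of_dvd_X_pow_sub_one hn hgn
  set x := AdjoinRoot.root p with hx
  have hxn : x ^ n = 1 := by
    have h := (AdjoinRoot.mk_eq_zero (f := p)).2 hpn
    simpa [sub_eq_zero] using h
  have hmul : x ^ (n - 1) * x = 1 := by rw [← pow_succ, Nat.sub_add_cancel hn, hxn]
  let _ : Invertible x := ⟨x ^ (n - 1), hmul, by rw [mul_comm, hmul]⟩
  have h1 : AdjoinRoot.mk p (conjInv φ n g) =
      eval₂ (AdjoinRoot.of p) (⅟x) (g.map φ) := by
    rw [conjInv, coe_eval₂RingHom, hom_eval₂, eval₂_map, map_pow, AdjoinRoot.mk_X]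
    rfl
  have h2 : p ∣ conjInv φ n g ↔ p ∣ (g.map φ).reverse := by
    have h3 := eval₂_reverse_eq_zero_iff (AdjoinRoot.of p) (⅟x) (g.map φ)
    rw [invOf_invOf] at h3
    rw [← AdjoinRoot.mk_eq_zero, h1, ← h3, ← AdjoinRoot.mk_eq_zero, ← AdjoinRoot.aeval_eq]
    rfl
  have h3 : p ∣ (g.map φ).reverse ↔ p ∣ conjRecip φ g := by
    have hu : IsUnit (C ((g.map φ).coeff 0)⁻¹ : F[X]) :=
      isUnit_C.2 (inv_ne_zero (coeff_zero_map_ne φ hg0)).isUnit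
    rw [conjRecip, recipPoly, hu.dvd_mul_left]
  rw [h2, h3]
  constructor
  · intro h
    rw [← conjRecip_conjRecip hφ hg0 hg]
    exact conjRecip_dvd φ h
  · intro h
    rw [← conjRecip_conjRecip hφ hp0 hp]
    exact conjRecip_dvd φ h

theorem isHermitianLCD_iff_forall_irreducible {q : ℕ} {φ : F →+* F} (hφq : ∀ a, φ a = a ^ q)
    (hφ : ∀ a, φ (φ a) = a) {n : ℕ} (hn : 0 < n) (hsq : Squarefree (X ^ n - 1 : F[X]))
    {g : F[X]} (hg : g.Monic) (hgn : g ∣ X ^ n - 1) :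
    IsHermitianLCD q (cyclicCodeOf n g : Set (Fin n → F)) ↔
      ∀ p : F[X], p.Monic → Irreducible p → p ∣ X ^ n - 1 → conjRecip φ p ∣ g → p ∣ g := by
  rw [isHermitianLCD_cyclicCodeOf_iff hφq hn hgn]
  constructor
  · intro h p hp hirr hpn hpg
    rw [← dvd_conjInv_iff hφ hn hp hirr hpn hg hgn] at hpg
    by_contra hndvd
    obtain ⟨a, ha⟩ := hpn
    have h1 : X ^ n - 1 ∣ a * g := by
      refine h _ (dvd_mul_left g a) ?_
      rw [ha, mul_comm p a, mul_assoc]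
      exact mul_dvd_mul_left a (hpg.mul_left g)
    have ha0 : a ≠ 0 := by
      rintro rfl
      exact hsq.ne_zero (by rw [ha, mul_zero])
    rw [ha, mul_comm p a, mul_dvd_mul_iff_left ha0] at h1
    exact hndvd h1
  · intro h f hgf hf
    refine dvd_of_squarefree_of_forall_irreducible hsq fun p hp hirr hpn => ?_
    rcases hirr.prime.dvd_or_dvd (hpn.trans hf) with h1 | h1
    · exact h1
    · exact (h p hp hirr hpn ((dvd_conjInv_iff hφ hn hp hirr hpn hg hgn).1 h1)).trans hgf

/-- The monic divisors of a squarefree `m` correspond to the sets of monic irreducible divisors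
of `m`. -/
theorem ncard_monic_dvd_eq {m : F[X]} (hm : Squarefree m) [DecidableEq F[X]] {P : Finset F[X]}
    (hP : ∀ p, p ∈ P ↔ p.Monic ∧ Irreducible p ∧ p ∣ m) (φ : F[X] → F[X]) (hφ : ∀ p ∈ P, φ p ∈ P) :
    {g : F[X] | g.Monic ∧ g ∣ m ∧ ∀ p ∈ P, φ p ∣ g → p ∣ g}.ncard =
      (P.powerset.filter fun S => ∀ p ∈ P, φ p ∈ S → p ∈ S).card := by
  classical
  rw [← Set.ncard_coe_finset]
  refine Set.ncard_congr (fun g _ => P.filter fun p => p ∣ g) ?_ ?_ ?_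
  · rintro g ⟨-, -, h⟩
    simp only [Finset.coe_filter, Set.mem_ofPred_eq, Finset.mem_powerset, Finset.mem_filter]
    exact ⟨Finset.filter_subset _ _, fun p hp hφp => ⟨hp, h p hp hφp.2⟩⟩
  · rintro f g ⟨hf, hfm, -⟩ ⟨hg, hgm, -⟩ h
    have key : ∀ f g : F[X], f ∣ m → (P.filter fun p => p ∣ f) = (P.filter fun p => p ∣ g) →
        f ∣ g := by
      intro f g hfm h
      refine dvd_of_squarefree_of_forall_irreducible (hm.squarefree_of_dvd hfm)
        fun p hp hirr hpf => ?_
      have : p ∈ P.filter fun p => p ∣ g :=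
        h ▸ Finset.mem_filter.2 ⟨(hP p).2 ⟨hp, hirr, hpf.trans hfm⟩, hpf⟩
      exact (Finset.mem_filter.1 this).2
    exact eq_of_monic_of_associated hf hg
      (associated_of_dvd_dvd (key f g hfm h) (key g f hgm h.symm))
  · intro S hS
    simp only [Finset.coe_filter, Set.mem_ofPred_eq, Finset.mem_powerset] at hS
    obtain ⟨hSP, hS⟩ := hS
    have hmem : ∀ p ∈ P, p ∣ ∏ s ∈ S, s ↔ p ∈ S := by
      intro p hp
      obtain ⟨hmon, hirr, -⟩ := (hP p).1 hp
      refine ⟨fun h => ?_, fun h => Finset.dvd_prod_of_mem _ h⟩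
      obtain ⟨s, hs, hps⟩ := (hirr.prime.dvd_finsetProd_iff _).1 h
      obtain ⟨hsmon, hsirr, -⟩ := (hP s).1 (hSP hs)
      rwa [eq_of_monic_of_associated hmon hsmon (hirr.associated_of_dvd hsirr hps)]
    refine ⟨∏ s ∈ S, s, ⟨monic_prod_of_monic _ _ fun s hs => ((hP s).1 (hSP hs)).1, ?_, ?_⟩, ?_⟩
    · refine Finset.prod_dvd_of_isRelPrime ?_ fun s hs => ((hP s).1 (hSP hs)).2.2
      intro s hs t ht hst
      obtain ⟨hsmon, hsirr, -⟩ := (hP s).1 (hSP hs)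
      obtain ⟨htmon, htirr, -⟩ := (hP t).1 (hSP ht)
      exact hsirr.isRelPrime_iff_not_dvd.2 fun h =>
        hst (eq_of_monic_of_associated hsmon htmon (hsirr.associated_of_dvd htirr h))
    · intro p hp h
      rw [hmem _ (hφ p hp)] at h
      exact (hmem p hp).2 (hS p hp h)
    · ext p
      rw [Finset.mem_filter]
      exact ⟨fun h => (hmem p h.1).1 h.2, fun h => ⟨hSP h, (hmem p (hSP h)).2 h⟩⟩

end Factors

theorem conjPoly_eq_map {F : Type*} [Field F] {q : ℕ} {φ : F →+* F} (hφ : ∀ a, φ a = a ^ q)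
    (f : F[X]) : conjPoly q f = f.map φ := by
  simp [conjPoly, Polynomial.map, eval₂_eq_sum, hφ]

/-- If `u` is the number of monic irreducible factors `e` of `xⁿ − 1`
over `GF(q²)` with `e = ē*`, and `2v` the number of remaining monic irreducible factors,
then the number of cyclic Hermitian LCD codes of length `n` (i.e. of monic divisors `g`
of `xⁿ − 1` whose cyclic code is Hermitian LCD) is `2^(u+v)`. -/
theorem stmt1 {q n u v : ℕ} (hq : IsPrimePow q) (hn : 0 < n) (hco : Nat.Coprime n q)
    {F : Type*} [Field F] [Fintype F] (hF : Fintype.card F = q ^ 2)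
    (hu : {p : Polynomial F | p.Monic ∧ Irreducible p ∧ p ∣ X ^ n - 1 ∧
        recipPoly (conjPoly q p) = p}.ncard = u)
    (hv : {p : Polynomial F | p.Monic ∧ Irreducible p ∧ p ∣ X ^ n - 1 ∧
        recipPoly (conjPoly q p) ≠ p}.ncard = 2 * v) :
    {g : Polynomial F | g.Monic ∧ g ∣ X ^ n - 1 ∧
        IsHermitianLCD q ((cyclicCodeOf n g : Submodule F (Fin n → F)) :
          Set (Fin n → F))}.ncard = 2 ^ (u + v) := by

  classical
  obtain ⟨r, k, hr, hk, rfl⟩ := (isPrimePow_nat_iff q).1 hq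
  have : Fact r.Prime := ⟨hr⟩
  have : CharP F r := charP_of_card_eq_prime_pow (f := k * 2) (by rw [hF, pow_mul])
  obtain ⟨φ, hφq⟩ : ∃ φ : F →+* F, ∀ a, φ a = a ^ r ^ k := ⟨iterateFrobenius F r k, fun _ => rfl⟩
  have hφ : ∀ a, φ (φ a) = a := fun a => by
    rw [hφq, hφq, ← pow_mul, ← sq, ← hF, FiniteField.pow_card]
  have hsq : Squarefree (X ^ n - 1 : F[X]) := by
    refine (X_pow_sub_one_separable_iff.2 ?_).squarefree
    rw [Ne, CharP.cast_eq_zero_iff F r, ← hr.coprime_iff_not_dvd]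
    exact (Nat.Coprime.coprime_dvd_right (dvd_pow_self r hk.ne') hco).symm
  have hfin : {p : F[X] | p.Monic ∧ Irreducible p ∧ p ∣ X ^ n - 1}.Finite := by
    refine (UniqueFactorizationMonoid.primeFactors (X ^ n - 1 : F[X])).finite_toSet.subset ?_
    rintro p ⟨hp, hirr, hpn⟩
    rw [Finset.mem_coe, UniqueFactorizationMonoid.mem_primeFactors,
      UniqueFactorizationMonoid.mem_normalizedFactors_iff' hsq.ne_zero]
    exact ⟨hirr, hp.normalize_eq_self, hpn⟩
  have hP : ∀ p, p ∈ hfin.toFinset ↔ p.Monic ∧ Irreducible p ∧ p ∣ X ^ n - 1 :=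
    fun p => hfin.mem_toFinset
  have h0 : ∀ p ∈ hfin.toFinset, p.coeff 0 ≠ 0 := fun p hp =>
    coeff_zero_ne_of_dvd_X_pow_sub_one hn ((hP p).1 hp).2.2
  have hmem : ∀ p ∈ hfin.toFinset, conjRecip φ p ∈ hfin.toFinset := by
    intro p hp
    obtain ⟨hmon, hirr, hpn⟩ := (hP p).1 hp
    have hdvd : conjRecip φ p ∣ X ^ n - 1 := by
      rw [← conjRecip_X_pow_sub_one φ hn]
      exact conjRecip_dvd φ hpn
    exact (hP _).2 ⟨monic_conjRecip φ (h0 p hp), irreducible_conjRecip hφ (h0 p hp) hmon hirr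
      (coeff_zero_ne_of_dvd_X_pow_sub_one hn hdvd), hdvd⟩
  simp only [conjPoly_eq_map hφq] at hu hv
  rw [← card_powerset_filter_involution hfin.toFinset (conjRecip φ) hmem
    (fun p hp => conjRecip_conjRecip hφ (h0 p hp) ((hP p).1 hp).1) (u := u) (v := v),
    ← ncard_monic_dvd_eq hsq hP (conjRecip φ) hmem]
  · congr 1
    ext g
    refine and_congr_right fun hg => and_congr_right fun hgn => ?_
    rw [isHermitianLCD_iff_forall_irreducible hφq hφ hn hsq hg hgn]
    simp only [hP, and_imp]
  · rw [← hu, ← Set.ncard_coe_finset, Finset.coe_filter]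
    simp only [hP, and_assoc, conjRecip]
  · rw [← hv, ← Set.ncard_coe_finset, Finset.coe_filter]
    simp only [hP, and_assoc, conjRecip]
end

section
/- Let q be a prime power, Q = q², and t ≥ 0 an integer. Then every cyclic code of length n = q^{2t+1} + 1 over GF(Q) is a Hermitian LCD code. -/
open Polynomial

noncomputable section

/-- The element `∑ i, c i · xⁱ` of the group algebra attached to a vector `c`. -/
def groupAlgOfVec {F : Type*} [Field F] {m : ℕ} (c : Fin (m + 1) → F) :
    AddMonoidAlgebra F (Fin (m + 1)) :=
  ∑ i, AddMonoidAlgebra.single i (c i)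

end

theorem groupAlgOfVec_apply {F : Type*} [Field F] {m : ℕ} (c : Fin (m + 1) → F)
    (i : Fin (m + 1)) : (groupAlgOfVec c).coeff i = c i := by
  classical
  simp [groupAlgOfVec, AddMonoidAlgebra.coeff_sum, Finsupp.finsetSum_apply, Finsupp.single_apply]

theorem smul_fin_eq_neg {m : ℕ} (i : Fin (m + 1)) : m • i = -i := by
  have h : (m + 1) • i = 0 := by
    have := card_nsmul_eq_zero (x := i)
    simpa using this
  rw [succ_nsmul] at h
  exact eq_neg_of_add_eq_zero_left h

/-- If `m` is a power of the characteristic, then the `m`-th power of `∑ i, c i · xⁱ`, modulo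
`x^(m+1) - 1`, is `∑ i, (c i)ᵐ · x⁻ⁱ`. -/
theorem groupAlgOfVec_pow {F : Type*} [Field F] {p e m : ℕ} [Fact p.Prime] [CharP F p]
    (hm : m = p ^ e) (c : Fin (m + 1) → F) :
    groupAlgOfVec c ^ m = groupAlgOfVec fun i => c (-i) ^ m := by
  have : CharP (AddMonoidAlgebra F (Fin (m + 1))) p :=
    charP_of_injective_algebraMap (algebraMap F _).injective p
  have h (k : ℕ) (hk : k = p ^ e) :
      groupAlgOfVec c ^ k = ∑ i, AddMonoidAlgebra.single i (c i) ^ k := by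
    subst hk
    exact sum_pow_char_pow p e _ _
  rw [h m hm, groupAlgOfVec, ← Equiv.sum_comp (Equiv.neg _)]
  refine Finset.sum_congr rfl fun i _ => ?_
  simp [AddMonoidAlgebra.single_pow, smul_fin_eq_neg]

/-- Coefficients of a product in the group algebra are given by cyclic convolution. -/
theorem groupAlgOfVec_mul {F : Type*} [Field F] {m : ℕ} (b c : Fin (m + 1) → F) :
    groupAlgOfVec b * groupAlgOfVec c = groupAlgOfVec fun d => ∑ i, b i * c (d - i) := by
  have h (i : Fin (m + 1)) :
      ∑ j, AddMonoidAlgebra.single (i + j) (b i * c j) =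
        ∑ d, AddMonoidAlgebra.single d (b i * c (d - i)) := by
    rw [← Equiv.sum_comp (Equiv.addLeft i)
      (fun d => AddMonoidAlgebra.single d (b i * c (d - i)))]
    simp
  simp only [groupAlgOfVec, Finset.sum_mul_sum, AddMonoidAlgebra.single_mul_single, h]
  rw [Finset.sum_comm]
  refine Finset.sum_congr rfl fun d _ => ?_
  exact (map_sum (AddMonoidAlgebra.singleAddHom d) _ _).symm

theorem cyclicShift_eq_sub_one {F : Type*} {m : ℕ} (c : Fin (m + 1) → F) :
    cyclicShift c = fun i => c (i - 1) := by
  funext i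
  unfold cyclicShift
  congr 1
  rcases m with _ | m
  · exact Subsingleton.elim (α := Fin 1) _ _
  · ext
    have h : 1 % (1 + (m + 1)) = 1 := Nat.mod_eq_of_lt (by lia)
    simp [Fin.sub_def, h, add_comm]

theorem IsCyclicCode.shift_mem {F : Type*} [Field F] {m : ℕ}
    {C : Submodule F (Fin (m + 1) → F)} (hC : IsCyclicCode C) {c : Fin (m + 1) → F} (hc : c ∈ C)
    (d : Fin (m + 1)) : (fun i => c (i - d)) ∈ C := by
  induction d using Fin.induction with
  | zero => simpa using hc
  | succ k ih =>
    have h := hC _ ih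
    rw [cyclicShift_eq_sub_one] at h
    convert h using 3
    rw [← Fin.coeSucc_eq_succ]
    abel

/-- A cyclic code of length `m + 1` over a field whose elements satisfy `xᵐ = x^q` and
`(xᵐ)ᵐ = x`, where `m` is a power of the characteristic, is Hermitian LCD. -/
theorem IsCyclicCode.isHermitianLCD {F : Type*} [Field F] {p e m q : ℕ} [Fact p.Prime]
    [CharP F p] (hm : m = p ^ e) (hm1 : 1 < m) (hq : ∀ x : F, x ^ m = x ^ q)
    (hmm : ∀ x : F, (x ^ m) ^ m = x)
    {C : Submodule F (Fin (m + 1) → F)} (hC : IsCyclicCode C) :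
    IsHermitianLCD q (C : Set (Fin (m + 1) → F)) := by
  refine Set.Subset.antisymm ?_ ?_
  · rintro b ⟨hb, hbd⟩
    have h1 : groupAlgOfVec b * groupAlgOfVec b ^ m = 0 := by
      rw [groupAlgOfVec_pow hm, groupAlgOfVec_mul]
      have (d : Fin (m + 1)) : ∑ i, b i * b (-(d - i)) ^ m = 0 := by
        simpa [hq] using hbd _ (hC.shift_mem hb d)
      simp only [this]
      simp [groupAlgOfVec]
    have h2 : (groupAlgOfVec b ^ m) ^ m = groupAlgOfVec b := by
      rw [groupAlgOfVec_pow hm, groupAlgOfVec_pow hm]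
      simp [hmm]
    have h3 : groupAlgOfVec b = 0 := by
      rw [← h2, ← pow_mul]
      refine pow_eq_zero_of_le (m := m + 1) (by nlinarith) ?_
      rw [pow_succ', h1]
    ext i
    rw [← groupAlgOfVec_apply b i, h3]
    simp
  · rintro _ rfl
    exact ⟨C.zero_mem, fun c _ => by simp⟩

/-- Every cyclic code of length `n = q^{2t+1} + 1` over `GF(q²)`
is a Hermitian LCD code. -/
theorem stmt4 {q t : ℕ} (hq : IsPrimePow q)
    {F : Type*} [Field F] [Fintype F] (hF : Fintype.card F = q ^ 2)
    (C : Submodule F (Fin (q ^ (2 * t + 1) + 1) → F)) (hC : IsCyclicCode C) :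
    IsHermitianLCD q (C : Set (Fin (q ^ (2 * t + 1) + 1) → F)) := by
  obtain ⟨p, k, hp, hk, rfl⟩ := hq
  have hp' : p.Prime := hp.nat_prime
  have : Fact p.Prime := ⟨hp'⟩
  have : CharP F p := charP_of_card_eq_prime_pow (f := k * 2) (by rw [hF, pow_mul])
  have hQ (s : ℕ) (x : F) : x ^ ((p ^ k) ^ (2 * s)) = x := by
    rw [pow_mul, ← hF, FiniteField.pow_card_pow]
  have hq1 : 1 < p ^ k := Nat.one_lt_pow hk.ne' hp'.one_lt
  refine hC.isHermitianLCD (p := p) (e := k * (2 * t + 1)) (pow_mul ..).symm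
    (Nat.one_lt_pow (by lia) hq1) (fun x => ?_) (fun x => ?_)
  · rw [pow_succ, pow_mul, hQ]
  · rw [← pow_mul, ← pow_add, ← two_mul, hQ]
end
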